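/- Under the stated hypotheses on Φ and f, one has Y2_{y2}(0) = (f(0)·G(0))² and c·Y2_{y2}(0) = c̃·(f(0)·G(0))²; consequently c = c̃. -/

import Mathlib

noncomputable section

/-- The model space `ℝ^13` with coordinates
`(t, x0, y0, x1, y1, x2, y2, x3, y3, x4, y4, x5, y5)`
indexed by `0, 1, ..., 12` respectively. -/
abbrev E13 := Fin 13 → ℝ

/-- The constant coordinate vector field `∂_u` of the `i`-th coordinate. -/
def e (i : Fin 13) : E13 := Pi.single i 1

/-- Partial derivative of a scalar function `F` in the `i`-th coordinate
direction, at a point `p`. -/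
def pd (F : E13 → ℝ) (i : Fin 13) (p : E13) : ℝ := fderiv ℝ F p (e i)

/-- The vector field `Z'_{1,a}` of the EKR pseudo-normal form for the
singularity class 1.2.2.1.2:
`Z'_{1,a} = ∂_{x4} + (a + y5)·∂_{y4} + x5·( ∂_{x2} + y3·∂_{y2} + (1 + x4)·∂_{x3}
 + (1 + y4)·∂_{y3} + x3·( ∂_{x1} + y2·∂_{y1} + x2·( ∂_t + x1·∂_{x0} + y1·∂_{y0} ) ) )`. -/
def Z (a : ℝ) (p : E13) : E13 :=
  e 9 + (a + p 12) • e 10 +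
    p 11 • (e 5 + p 8 • e 6 + (1 + p 9) • e 7 + (1 + p 10) • e 8 +
      p 7 • (e 3 + p 6 • e 4 + p 5 • (e 0 + p 3 • e 1 + p 4 • e 2)))

open Filter Topology

/-- The bracket `∂_t + x1·∂_{x0} + y1·∂_{y0}` of `Z'_{1,a}`. -/
def innerField (p : E13) : E13 := e 0 + p 3 • e 1 + p 4 • e 2

/-- The bracket `∂_{x1} + y2·∂_{y1} + x2·(⋯)` of `Z'_{1,a}`. -/
def middleField (p : E13) : E13 := e 3 + p 6 • e 4 + p 5 • innerField p

/-- The coefficient of `x5` in `Z'_{1,a}`. -/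
def outerField (p : E13) : E13 :=
  e 5 + p 8 • e 6 + (1 + p 9) • e 7 + (1 + p 10) • e 8 + p 7 • middleField p

lemma Z_eq (a : ℝ) (p : E13) :
    Z a p = e 9 + (a + p 12) • e 10 + p 11 • outerField p := rfl

lemma e_apply (i j : Fin 13) : e i j = if j = i then 1 else 0 := by
  simp [e, Pi.single_apply]

lemma continuous_innerField : Continuous innerField := by
  unfold innerField; fun_prop

lemma continuous_middleField : Continuous middleField := by
  have := continuous_innerField
  unfold middleField; fun_prop

lemma continuous_outerField : Continuous outerField := by
  have := continuous_middleField
  unfold outerField; fun_prop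

/-- A common factor `p k` can be cancelled from an identity of continuous functions. -/
lemma eq_of_coord_mul_eq {U : Set E13} (hU : IsOpen U) (k : Fin 13) {F₁ F₂ : E13 → ℝ}
    (h₁ : ContinuousOn F₁ U) (h₂ : ContinuousOn F₂ U)
    (h : ∀ p ∈ U, p k * F₁ p = p k * F₂ p) : ∀ p ∈ U, F₁ p = F₂ p := by
  intro p hp
  by_cases hk : p k = 0
  · have hline : Tendsto (fun s : ℝ => p + s • e k) (𝓝[≠] 0) (𝓝 p) := by
      have : Continuous (fun s : ℝ => p + s • e k) := by fun_prop
      have h0 := this.tendsto 0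
      simp only [zero_smul, add_zero] at h0
      exact h0.mono_left nhdsWithin_le_nhds
    have t₁ := (h₁.continuousAt (hU.mem_nhds hp)).tendsto.comp hline
    have t₂ := (h₂.continuousAt (hU.mem_nhds hp)).tendsto.comp hline
    refine tendsto_nhds_unique_of_eventuallyEq t₁ t₂ ?_
    filter_upwards [hline.eventually (hU.mem_nhds hp), self_mem_nhdsWithin] with s hs hs0
    have := h _ hs
    simp only [Pi.add_apply, Pi.smul_apply, e_apply, hk, if_true, smul_eq_mul, mul_one,
      zero_add] at this
    exact mul_left_cancel₀ hs0 this
  · exact mul_left_cancel₀ hk (h p hp)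

lemma fderiv_add_smul_of_invariant {F : E13 → ℝ} {k : Fin 13}
    (h : ∀ p (s : ℝ), F (p + s • e k) = F p) (p : E13) (s : ℝ) :
    fderiv ℝ F (p + s • e k) = fderiv ℝ F p := by
  rw [← fderiv_comp_add_right]
  simp only [h]

lemma hasDerivAt_axis {F : E13 → ℝ} {k : Fin 13} {s : ℝ}
    (h : DifferentiableAt ℝ F (s • e k)) :
    HasDerivAt (fun r : ℝ => F (r • e k)) (fderiv ℝ F (s • e k) (e k)) s := by
  have hl : HasDerivAt (fun r : ℝ => r • e k) (e k) s := by
    simpa using (hasDerivAt_id s).smul_const (e k)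
  exact h.hasFDerivAt.comp_hasDerivAt s hl

lemma fderiv_apply_eq_zero_of_invariant {F : E13 → ℝ} {k : Fin 13}
    (h : ∀ p (s : ℝ), F (p + s • e k) = F p) (p : E13) :
    fderiv ℝ F p (e k) = 0 := by
  by_cases hd : DifferentiableAt ℝ F p
  · have := hd.lineDeriv_eq_fderiv (v := e k)
    rw [← this, lineDeriv]
    simp [h]
  · simp [fderiv_zero_of_not_differentiableAt hd]

lemma hasDerivAt_axis_zero {F : E13 → ℝ} (k : Fin 13) (h : DifferentiableAt ℝ F 0) :
    HasDerivAt (fun r : ℝ => F (r • e k)) (fderiv ℝ F 0 (e k)) 0 := by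
  have := hasDerivAt_axis (F := F) (k := k) (s := 0) (by simpa using h)
  simpa using this

/-- If `s·a = m·F` along a coordinate axis and `F` vanishes at `0`, then `a = m(0)·∂F(0)`. -/
lemma eq_mul_fderiv_of_axis {F m : E13 → ℝ} {k : Fin 13} {a : ℝ}
    (hF : DifferentiableAt ℝ F 0) (hm : DifferentiableAt ℝ m 0) (hF0 : F 0 = 0)
    (h : ∀ᶠ s : ℝ in 𝓝 0, s * a = m (s • e k) * F (s • e k)) :
    a = m 0 * fderiv ℝ F 0 (e k) := by
  have h₁ := (hasDerivAt_axis_zero k hm).mul (hasDerivAt_axis_zero k hF)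
  have h₂ : HasDerivAt (fun s : ℝ => s * a) a 0 := by
    simpa using (hasDerivAt_id (0 : ℝ)).mul_const a
  have := h₂.unique (h₁.congr_of_eventuallyEq h)
  simpa [hF0] using this

/-- If `F` is affine along a coordinate axis near `0`, its slope is the partial derivative. -/
lemma fderiv_axis_of_eventually_eq {F : E13 → ℝ} {k : Fin 13} {a : ℝ}
    (hF : DifferentiableAt ℝ F 0) (h : ∀ᶠ s : ℝ in 𝓝 0, F (s • e k) = s * a) :
    fderiv ℝ F 0 (e k) = a := by
  have h₂ : HasDerivAt (fun s : ℝ => s * a) a 0 := by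
    simpa using (hasDerivAt_id (0 : ℝ)).mul_const a
  exact (hasDerivAt_axis_zero k hF).unique (h₂.congr_of_eventuallyEq h)

lemma eventually_axis {P : E13 → Prop} (k : Fin 13) (h : ∀ᶠ p in 𝓝 (0 : E13), P p) :
    ∀ᶠ s : ℝ in 𝓝 0, P (s • e k) := by
  have : Continuous (fun s : ℝ => s • e k) := by fun_prop
  have h0 := this.tendsto 0
  simp only [zero_smul] at h0
  exact h0.eventually h

/-- If `F` vanishes along a coordinate axis near `0`, so does its derivative in that direction. -/
lemma eventually_fderiv_axis_eq_zero {F : E13 → ℝ} {k : Fin 13}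
    (hd : ∀ᶠ p in 𝓝 (0 : E13), DifferentiableAt ℝ F p)
    (h : ∀ᶠ s : ℝ in 𝓝 0, F (s • e k) = 0) :
    ∀ᶠ s : ℝ in 𝓝 0, fderiv ℝ F (s • e k) (e k) = 0 := by
  filter_upwards [eventually_axis k hd, h.eventually_nhds] with s hs hs'
  exact (hasDerivAt_axis hs).unique ((hasDerivAt_const s (0 : ℝ)).congr_of_eventuallyEq hs')

lemma apply_eq_zero_of_mem_span {v : E13}
    (hv : v ∈ Submodule.span ℝ ({e 11, e 12} : Set E13)) {i : Fin 13} (hi : (i : ℕ) ≤ 10) :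
    v i = 0 := by
  obtain ⟨a, b, rfl⟩ := Submodule.mem_span_pair.1 hv
  have h₁ : i ≠ 11 := by rintro rfl; exact absurd hi (by decide)
  have h₂ : i ≠ 12 := by rintro rfl; exact absurd hi (by decide)
  simp [e_apply, h₁, h₂]

/-- `Y2_{y2}(0) = (f(0)·G(0))²` and `c·Y2_{y2}(0) = c'·(f(0)·G(0))²`; consequently `c = c'`. -/
theorem final_relations_12212 (c c' : ℝ)
    (Φ : E13 → E13) (U : Set E13) (hU : IsOpen U) (h0U : (0 : E13) ∈ U)
    (hΦsmooth : ContDiffOn ℝ (⊤ : ℕ∞) Φ U) (hΦ0 : Φ 0 = 0)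
    (hdiffeo : Function.Bijective (fderiv ℝ Φ 0))
    -- the components `T, X0, Y0` (indices 0,1,2) depend only on `t, x0, y0`
    (htri0 : ∀ p q : E13, (∀ k : Fin 13, (k : ℕ) ≤ 2 → p k = q k) →
      ∀ i : Fin 13, (i : ℕ) ≤ 2 → Φ p i = Φ q i)
    -- for `1 ≤ j ≤ 5`, the components `Xj, Yj` (indices 2j+1, 2j+2)
    -- depend only on `t, x0, y0, x1, y1, ..., xj, yj`
    (htri : ∀ j : ℕ, 1 ≤ j → j ≤ 5 → ∀ p q : E13,
      (∀ k : Fin 13, (k : ℕ) ≤ 2 * j + 2 → p k = q k) →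
      ∀ i : Fin 13, ((i : ℕ) = 2 * j + 1 ∨ (i : ℕ) = 2 * j + 2) → Φ p i = Φ q i)
    (K H G : E13 → ℝ)
    (hKs : ContDiffOn ℝ (⊤ : ℕ∞) K U) (hHs : ContDiffOn ℝ (⊤ : ℕ∞) H U) (hGs : ContDiffOn ℝ (⊤ : ℕ∞) G U)
    (hK0 : K 0 ≠ 0) (hH0 : H 0 ≠ 0) (hG0 : G 0 ≠ 0)
    -- `X2 = x2·K`, `X3 = x3·H`, `X5 = x5·G`
    (hX2 : ∀ p ∈ U, Φ p 5 = p 5 * K p)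
    (hX3 : ∀ p ∈ U, Φ p 7 = p 7 * H p)
    (hX5 : ∀ p ∈ U, Φ p 11 = p 11 * G p)
    (f : E13 → ℝ) (hfs : ContDiffOn ℝ (⊤ : ℕ∞) f U) (hf0 : f 0 ≠ 0)
    -- `dΦ(p)·Z_{1,c}(p) − f(p)·Z_{1,c'}(Φ(p)) ∈ span{∂_{x5}, ∂_{y5}}` near 0
    (hconj : ∀ p ∈ U, fderiv ℝ Φ p (Z c p) - f p • Z c' (Φ p) ∈
      Submodule.span ℝ ({e 11, e 12} : Set E13)) :
    pd (fun p => Φ p 6) 6 0 = (f 0 * G 0) ^ 2 ∧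
      c * pd (fun p => Φ p 6) 6 0 = c' * (f 0 * G 0) ^ 2 ∧ c = c' := by
  have hΦd : ∀ i, ContDiffOn ℝ (⊤ : ℕ∞) (fun p => Φ p i) U := fun i => contDiffOn_pi.1 hΦsmooth i
  have hU0 : U ∈ 𝓝 (0 : E13) := hU.mem_nhds h0U
  have hUax : ∀ k, ∀ᶠ s : ℝ in 𝓝 0, s • e k ∈ U := fun k => eventually_axis k hU0
  have diff : ∀ i, ∀ p ∈ U, DifferentiableAt ℝ (fun p => Φ p i) p := fun i p hp =>
    ((hΦd i).differentiableOn (by simp)).differentiableAt (hU.mem_nhds hp)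
  have diff0 : ∀ i, DifferentiableAt ℝ (fun p => Φ p i) 0 := fun i => diff i 0 h0U
  have diffev : ∀ i, ∀ᶠ p in 𝓝 (0 : E13), DifferentiableAt ℝ (fun p => Φ p i) p := fun i => by
    filter_upwards [hU0] with p hp using diff i p hp
  have hfd : DifferentiableAt ℝ f 0 := (hfs.differentiableOn (by simp)).differentiableAt hU0
  have hGd : DifferentiableAt ℝ G 0 := (hGs.differentiableOn (by simp)).differentiableAt hU0
  have hHd : DifferentiableAt ℝ H 0 := (hHs.differentiableOn (by simp)).differentiableAt hU0
  have hKd : DifferentiableAt ℝ K 0 := (hKs.differentiableOn (by simp)).differentiableAt hU0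
  have hfc := hfs.continuousOn
  have hGc := hGs.continuousOn
  have hHc := hHs.continuousOn
  have hKc := hKs.continuousOn
  -- invariance of the components
  have inv : ∀ j : ℕ, j ≤ 4 → ∀ i k : Fin 13, (i : ℕ) ≤ 2 * j + 2 → 2 * j + 2 < (k : ℕ) →
      ∀ p (s : ℝ), Φ (p + s • e k) i = Φ p i := by
    intro j hj i k hi hk p s
    have hcoord : ∀ n : ℕ, n < k → ∀ l : Fin 13, (l : ℕ) ≤ n → (p + s • e k) l = p l := by
      intro n hn l hl
      have : l ≠ k := by rintro rfl; omega
      simp [e_apply, this]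
    by_cases hi2 : (i : ℕ) ≤ 2
    · exact htri0 _ _ (hcoord 2 (by omega)) i hi2
    · refine htri (((i : ℕ) - 1) / 2) (by omega) (by omega) _ _ (hcoord _ (by omega)) i (by omega)
  have dinv : ∀ j : ℕ, j ≤ 4 → ∀ i k : Fin 13, (i : ℕ) ≤ 2 * j + 2 → 2 * j + 2 < (k : ℕ) →
      ∀ s : ℝ, fderiv ℝ (fun p => Φ p i) (s • e k) = fderiv ℝ (fun p => Φ p i) 0 := by
    intro j hj i k hi hk s
    simpa using fderiv_add_smul_of_invariant (F := fun p => Φ p i) (inv j hj i k hi hk) 0 s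
  have dzero : ∀ j : ℕ, j ≤ 4 → ∀ i k : Fin 13, (i : ℕ) ≤ 2 * j + 2 → 2 * j + 2 < (k : ℕ) →
      ∀ p, fderiv ℝ (fun p => Φ p i) p (e k) = 0 := fun j hj i k hi hk =>
    fderiv_apply_eq_zero_of_invariant (F := fun p => Φ p i) (inv j hj i k hi hk)
  have dcont : ∀ i (V : E13 → E13), Continuous V →
      ContinuousOn (fun p => fderiv ℝ (fun p => Φ p i) p (V p)) U := fun i V hV =>
    ((hΦd i).continuousOn_fderiv_of_isOpen hU (by simp)).clm_apply hV.continuousOn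
  -- the conjugacy relation, stripped of its common factors one bracket at a time
  have conj : ∀ i : Fin 13, (i : ℕ) ≤ 10 → ∀ p ∈ U,
      fderiv ℝ (fun p => Φ p i) p (Z c p) = f p * Z c' (Φ p) i := by
    intro i hi p hp
    have h := apply_eq_zero_of_mem_span (hconj p hp) hi
    have hd : DifferentiableAt ℝ Φ p :=
      (hΦsmooth.differentiableOn (by simp)).differentiableAt (hU.mem_nhds hp)
    rw [fderiv_apply hd i]
    simpa [sub_eq_zero] using h
  have outer : ∀ i : Fin 13, (i : ℕ) ≤ 8 → ∀ p ∈ U, fderiv ℝ (fun p => Φ p i) p (outerField p) =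
      f p * G p * outerField (Φ p) i := by
    intro i hi
    have hc := (continuous_apply i).comp continuous_outerField
    refine eq_of_coord_mul_eq hU 11 (dcont i _ continuous_outerField)
      ((hfc.mul hGc).mul (hc.comp_continuousOn hΦsmooth.continuousOn)) fun p hp => ?_
    have h := conj i (by omega) p hp
    have h9 : i ≠ 9 := by rintro rfl; exact absurd hi (by decide)
    have h10 : i ≠ 10 := by rintro rfl; exact absurd hi (by decide)
    simp only [Z_eq, map_add, map_smul, smul_eq_mul, dzero 3 (by norm_num) i 9 hi (by decide),
      dzero 3 (by norm_num) i 10 hi (by decide), Pi.add_apply, Pi.smul_apply, e_apply, h9, h10,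
      if_false, hX5 p hp] at h
    linear_combination h
  have middle : ∀ i : Fin 13, (i : ℕ) ≤ 4 → ∀ p ∈ U,
      fderiv ℝ (fun p => Φ p i) p (middleField p) =
      f p * G p * H p * middleField (Φ p) i := by
    intro i hi
    have hc := (continuous_apply i).comp continuous_middleField
    refine eq_of_coord_mul_eq hU 7 (dcont i _ continuous_middleField)
      (((hfc.mul hGc).mul hHc).mul (hc.comp_continuousOn hΦsmooth.continuousOn)) fun p hp => ?_
    have h := outer i (by omega) p hp
    have h5 : i ≠ 5 := by rintro rfl; exact absurd hi (by decide)
    have h6 : i ≠ 6 := by rintro rfl; exact absurd hi (by decide)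
    have h7 : i ≠ 7 := by rintro rfl; exact absurd hi (by decide)
    have h8 : i ≠ 8 := by rintro rfl; exact absurd hi (by decide)
    simp only [outerField, map_add, map_smul, smul_eq_mul,
      dzero 1 (by norm_num) i 5 hi (by decide), dzero 1 (by norm_num) i 6 hi (by decide),
      dzero 1 (by norm_num) i 7 hi (by decide), dzero 1 (by norm_num) i 8 hi (by decide),
      Pi.add_apply, Pi.smul_apply, e_apply, h5, h6, h7, h8, if_false, hX3 p hp] at h
    linear_combination h
  have inner : ∀ i : Fin 13, (i : ℕ) ≤ 2 → ∀ p ∈ U,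
      fderiv ℝ (fun p => Φ p i) p (innerField p) =
      f p * G p * H p * K p * innerField (Φ p) i := by
    intro i hi
    have hc := (continuous_apply i).comp continuous_innerField
    refine eq_of_coord_mul_eq hU 5 (dcont i _ continuous_innerField)
      ((((hfc.mul hGc).mul hHc).mul hKc).mul (hc.comp_continuousOn hΦsmooth.continuousOn))
      fun p hp => ?_
    have h := middle i (by omega) p hp
    have h3 : i ≠ 3 := by rintro rfl; exact absurd hi (by decide)
    have h4 : i ≠ 4 := by rintro rfl; exact absurd hi (by decide)
    simp only [middleField, map_add, map_smul, smul_eq_mul,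
      dzero 0 (by norm_num) i 3 hi (by decide), dzero 0 (by norm_num) i 4 hi (by decide),
      Pi.add_apply, Pi.smul_apply, e_apply, h3, h4, if_false, hX2 p hp] at h
    linear_combination h
  have fG0 : f 0 * G 0 ≠ 0 := mul_ne_zero hf0 hG0
  have fGH0 : f 0 * G 0 * H 0 ≠ 0 := mul_ne_zero fG0 hH0
  have fGHK0 : f 0 * G 0 * H 0 * K 0 ≠ 0 := mul_ne_zero fGH0 hK0
  have fGne : ∀ k, ∀ᶠ s : ℝ in 𝓝 0, f (s • e k) * G (s • e k) ≠ 0 := fun k =>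
    eventually_axis k ((hfd.mul hGd).continuousAt.eventually_ne fG0)
  have fGHne : ∀ k, ∀ᶠ s : ℝ in 𝓝 0, f (s • e k) * G (s • e k) * H (s • e k) ≠ 0 := fun k =>
    eventually_axis k (((hfd.mul hGd).mul hHd).continuousAt.eventually_ne fGH0)
  have fGHKne : ∀ k, ∀ᶠ s : ℝ in 𝓝 0,
      f (s • e k) * G (s • e k) * H (s • e k) * K (s • e k) ≠ 0 := fun k =>
    eventually_axis k ((((hfd.mul hGd).mul hHd).mul hKd).continuousAt.eventually_ne fGHK0)
  -- first-order relations at the origin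
  have Y0t : fderiv ℝ (fun p => Φ p 2) 0 (e 0) = 0 := by
    simpa [innerField, e_apply, hΦ0] using inner 2 (by decide) 0 h0U
  have Y1x1 : fderiv ℝ (fun p => Φ p 4) 0 (e 3) = 0 := by
    simpa [middleField, e_apply, hΦ0] using middle 4 (by decide) 0 h0U
  have Y2x2 : fderiv ℝ (fun p => Φ p 6) 0 (e 5) = 0 := by
    simpa [outerField, e_apply, hΦ0, dzero 2 (by norm_num) 6 7 (by decide) (by decide),
      dzero 2 (by norm_num) 6 8 (by decide) (by decide)] using outer 6 (by decide) 0 h0U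
  -- the `x1`-axis
  have Y1_axis : ∀ᶠ s : ℝ in 𝓝 0, Φ (s • e 3) 4 = 0 := by
    have key : ∀ᶠ s : ℝ in 𝓝 0, s * fderiv ℝ (fun p => Φ p 2) 0 (e 1) =
        (f (s • e 3) * G (s • e 3) * H (s • e 3) * K (s • e 3)) * Φ (s • e 3) 4 := by
      filter_upwards [hUax 3] with s hs
      simpa [innerField, e_apply, Y0t, dinv 0 (by norm_num) 2 3 (by decide) (by decide)]
        using inner 2 (by decide) _ hs
    have h0 := eq_mul_fderiv_of_axis (F := fun p => Φ p 4)
      (m := fun p => f p * G p * H p * K p) (diff0 4) (((hfd.mul hGd).mul hHd).mul hKd)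
      (by simp [hΦ0]) key
    filter_upwards [key, fGHKne 3] with s hs hne
    rw [h0, Y1x1, mul_zero, mul_zero] at hs
    exact (mul_eq_zero.1 hs.symm).resolve_left hne
  have Y2x1 : fderiv ℝ (fun p => Φ p 6) 0 (e 3) = 0 := by
    refine fderiv_axis_of_eventually_eq (diff0 6) ?_
    filter_upwards [eventually_fderiv_axis_eq_zero (diffev 4) Y1_axis, hUax 3, fGHne 3]
      with s hs hsU hne
    have h := middle 4 (by decide) _ hsU
    simp [middleField, innerField, e_apply, hs] at h
    simp only [mul_zero]
    simp only [ne_eq, mul_eq_zero] at hne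
    tauto
  -- the `x2`-axis
  have Y2_axis : ∀ᶠ s : ℝ in 𝓝 0, Φ (s • e 5) 6 = 0 := by
    have key : ∀ᶠ s : ℝ in 𝓝 0, s * fderiv ℝ (fun p => Φ p 4) 0 (e 0) =
        (f (s • e 5) * G (s • e 5) * H (s • e 5)) * Φ (s • e 5) 6 := by
      filter_upwards [hUax 5] with s hs
      simpa [middleField, innerField, e_apply, Y1x1,
        dinv 1 (by norm_num) 4 5 (by decide) (by decide)] using middle 4 (by decide) _ hs
    have h0 := eq_mul_fderiv_of_axis (F := fun p => Φ p 6)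
      (m := fun p => f p * G p * H p) (diff0 6) ((hfd.mul hGd).mul hHd) (by simp [hΦ0]) key
    filter_upwards [key, fGHne 5] with s hs hne
    rw [h0, Y2x2, mul_zero, mul_zero] at hs
    exact (mul_eq_zero.1 hs.symm).resolve_left hne
  have Y3x2 : fderiv ℝ (fun p => Φ p 8) 0 (e 5) = 0 := by
    refine fderiv_axis_of_eventually_eq (diff0 8) ?_
    filter_upwards [eventually_fderiv_axis_eq_zero (diffev 6) Y2_axis, hUax 5, fGne 5]
      with s hs hsU hne
    have h := outer 6 (by decide) _ hsU
    simp [outerField, middleField, innerField, e_apply, hs,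
      dzero 2 (by norm_num) 6 7 (by decide) (by decide),
      dzero 2 (by norm_num) 6 8 (by decide) (by decide)] at h
    simp only [mul_zero]
    simp only [ne_eq, mul_eq_zero] at hne
    tauto
  -- the `x3`- and `y3`-axes
  have Y3x3 : fderiv ℝ (fun p => Φ p 8) 0 (e 7) = 0 := by
    refine fderiv_axis_of_eventually_eq (diff0 8) ?_
    filter_upwards [hUax 7, fGne 7] with s hsU hne
    have h := outer 6 (by decide) _ hsU
    rw [dinv 2 (by norm_num) 6 7 (by decide) (by decide)] at h
    simp [outerField, middleField, innerField, e_apply, Y2x2, Y2x1,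
      dzero 2 (by norm_num) 6 7 (by decide) (by decide),
      dzero 2 (by norm_num) 6 8 (by decide) (by decide)] at h
    simp only [mul_zero]
    simp only [ne_eq, mul_eq_zero] at hne
    tauto
  have Y2y2 : fderiv ℝ (fun p => Φ p 6) 0 (e 6) =
      f 0 * G 0 * fderiv ℝ (fun p => Φ p 8) 0 (e 8) := by
    refine eq_mul_fderiv_of_axis (m := fun p => f p * G p) (diff0 8) (hfd.mul hGd)
      (by simp [hΦ0]) ?_
    filter_upwards [hUax 8] with s hsU
    have h := outer 6 (by decide) _ hsU
    rw [dinv 2 (by norm_num) 6 8 (by decide) (by decide)] at h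
    simpa [outerField, middleField, innerField, e_apply, Y2x2,
      dzero 2 (by norm_num) 6 7 (by decide) (by decide),
      dzero 2 (by norm_num) 6 8 (by decide) (by decide)] using h
  have Y3y3 : fderiv ℝ (fun p => Φ p 8) 0 (e 8) = f 0 * G 0 := by
    simpa [outerField, middleField, innerField, e_apply, hΦ0, Y3x2, Y3x3] using outer 8 (by decide) 0 h0U
  -- derivatives of `X3` at the origin
  have X3_axis : ∀ k : Fin 13, k ≠ 7 → fderiv ℝ (fun p => Φ p 7) 0 (e k) = 0 := by
    intro k hk
    refine fderiv_axis_of_eventually_eq (diff0 7) ?_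
    filter_upwards [hUax k] with s hsU
    simp [hX3 _ hsU, e_apply, hk.symm]
  have X3x3 : fderiv ℝ (fun p => Φ p 7) 0 (e 7) = f 0 * G 0 := by
    simpa [outerField, middleField, innerField, e_apply, hΦ0, X3_axis 5 (by decide), X3_axis 8 (by decide)]
      using outer 7 (by decide) 0 h0U
  -- `f·G` is constant along the `x4`- and `y4`-axes
  have fG_const : ∀ k : Fin 13, (k = 9 ∨ k = 10) → ∀ s : ℝ, s • e k ∈ U →
      f (s • e k) * G (s • e k) = f 0 * G 0 := by
    have h0 := outer 5 (by decide) 0 h0U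
    rintro k (rfl | rfl) s hs
    all_goals
      have h := outer 5 (by decide) _ hs
      rw [dinv 2 (by norm_num) 5 _ (by decide) (by decide)] at h
      simp [outerField, middleField, innerField, e_apply, dzero 2 (by norm_num) 5 7 (by decide) (by decide),
        dzero 2 (by norm_num) 5 8 (by decide) (by decide)] at h h0
      rw [← h, ← h0]
  have X4x4 : fderiv ℝ (fun p => Φ p 9) 0 (e 9) = 1 := by
    refine fderiv_axis_of_eventually_eq (diff0 9) ?_
    filter_upwards [hUax 9] with s hsU
    have h := outer 7 (by decide) _ hsU
    rw [dinv 3 (by norm_num) 7 9 (by decide) (by decide), fG_const 9 (by simp) s hsU] at h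
    simp [outerField, middleField, innerField, e_apply, X3_axis 5 (by decide), X3_axis 8 (by decide), X3x3] at h
    apply mul_left_cancel₀ fG0
    linear_combination -h
  have X4y4 : fderiv ℝ (fun p => Φ p 9) 0 (e 10) = 0 := by
    refine fderiv_axis_of_eventually_eq (diff0 9) ?_
    filter_upwards [hUax 10] with s hsU
    have h := outer 7 (by decide) _ hsU
    rw [dinv 3 (by norm_num) 7 10 (by decide) (by decide), fG_const 10 (by simp) s hsU] at h
    simp [outerField, middleField, innerField, e_apply, X3_axis 5 (by decide), X3_axis 8 (by decide), X3x3] at h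
    apply mul_left_cancel₀ fG0
    linear_combination -h
  have Y4x4 : fderiv ℝ (fun p => Φ p 10) 0 (e 9) = 0 := by
    refine fderiv_axis_of_eventually_eq (diff0 10) ?_
    filter_upwards [hUax 9] with s hsU
    have h := outer 8 (by decide) _ hsU
    rw [dinv 3 (by norm_num) 8 9 (by decide) (by decide), fG_const 9 (by simp) s hsU] at h
    simp [outerField, middleField, innerField, e_apply, Y3x2, Y3x3, Y3y3] at h
    apply mul_left_cancel₀ fG0
    linear_combination -h
  have Y4y4 : fderiv ℝ (fun p => Φ p 10) 0 (e 10) = 1 := by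
    refine fderiv_axis_of_eventually_eq (diff0 10) ?_
    filter_upwards [hUax 10] with s hsU
    have h := outer 8 (by decide) _ hsU
    rw [dinv 3 (by norm_num) 8 10 (by decide) (by decide), fG_const 10 (by simp) s hsU] at h
    simp [outerField, middleField, innerField, e_apply, Y3x2, Y3x3, Y3y3] at h
    apply mul_left_cancel₀ fG0
    linear_combination -h
  have hf1 : 1 = f 0 := by
    simpa [Z_eq, e_apply, hΦ0, X4x4, X4y4] using conj 9 (by decide) 0 h0U
  have hcc : c = f 0 * c' := by
    simpa [Z_eq, e_apply, hΦ0, Y4x4, Y4y4] using conj 10 (by decide) 0 h0U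
  have hc : c = c' := by rw [hcc, ← hf1, one_mul]
  have hY : pd (fun p => Φ p 6) 6 0 = (f 0 * G 0) ^ 2 := by
    rw [pd, Y2y2, Y3y3, sq]
  exact ⟨hY, by rw [hY, hc], hc⟩
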